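/- Let S be a finite set of points in a metric space, let 1 ≤ k < |S|, let ε ≥ 0, and let T ⊆ S be a nonempty subset with r_T(S) ≤ ε · r*_k(S) (i.e., T is an (ε, k)-coreset for S). Then the optimal k-center radius of T satisfies r*_k(T) ≤ (1 + ε) · r*_k(S). -/

import Mathlib

/-- `setDist p C = min_{q ∈ C} dist p q` (as an infimum). -/
noncomputable def setDist {X : Type*} [MetricSpace X] (p : X) (C : Set X) : ℝ :=
  sInf ((dist p) '' C)

/-- `rad S C = max_{p ∈ S} dist(p, C)`, the radius of `C` with respect to `S`. -/
noncomputable def rad {X : Type*} [MetricSpace X] (S C : Set X) : ℝ :=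
  sSup ((fun p => setDist p C) '' S)

/-- `kcOpt S k = r*_k(S)`, the optimal `k`-center radius of `S`. -/
noncomputable def kcOpt {X : Type*} [MetricSpace X] (S : Set X) (k : ℕ) : ℝ :=
  sInf { r : ℝ | ∃ C : Set X, C ⊆ S ∧ C.Nonempty ∧ C.ncard ≤ k ∧ r = rad S C }

theorem bddBelow_dist_image {X : Type*} [MetricSpace X] (p : X) (C : Set X) :
    BddBelow (dist p '' C) :=
  ⟨0, by rintro _ ⟨q, -, rfl⟩; exact dist_nonneg⟩

theorem rad_nonneg {X : Type*} [MetricSpace X] (S C : Set X) : 0 ≤ rad S C := by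
  refine Real.sSup_nonneg ?_
  rintro _ ⟨p, -, rfl⟩
  refine Real.sInf_nonneg ?_
  rintro _ ⟨q, -, rfl⟩
  exact dist_nonneg

theorem exists_dist_le_rad {X : Type*} [MetricSpace X] {S C : Set X} (hS : S.Finite)
    (hC : C.Finite) (hCne : C.Nonempty) {p : X} (hp : p ∈ S) :
    ∃ q ∈ C, dist p q ≤ rad S C := by
  obtain ⟨q, hq, hpq⟩ := (hCne.image (dist p)).csInf_mem (hC.image (dist p))
  exact ⟨q, hq, hpq.trans_le (le_csSup (hS.image _).bddAbove (Set.mem_image_of_mem _ hp))⟩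

theorem rad_le {X : Type*} [MetricSpace X] {S C : Set X} (hSne : S.Nonempty) {r : ℝ}
    (h : ∀ p ∈ S, ∃ q ∈ C, dist p q ≤ r) : rad S C ≤ r := by
  refine csSup_le (hSne.image _) ?_
  rintro _ ⟨p, hp, rfl⟩
  obtain ⟨q, hq, hpq⟩ := h p hp
  exact (csInf_le (bddBelow_dist_image p C) (Set.mem_image_of_mem _ hq)).trans hpq

theorem kcOpt_le_rad {X : Type*} [MetricSpace X] {S C : Set X} {k : ℕ} (hCS : C ⊆ S)
    (hCne : C.Nonempty) (hCk : C.ncard ≤ k) : kcOpt S k ≤ rad S C := by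
  refine csInf_le ⟨0, ?_⟩ ⟨C, hCS, hCne, hCk, rfl⟩
  rintro _ ⟨D, -, -, -, rfl⟩
  exact rad_nonneg S D

/-- Moving each center of `C ⊆ S` to a nearest point of `T ⊆ S` costs at most `rad S T`. -/
theorem kcOpt_le_rad_add_rad {X : Type*} [MetricSpace X] {S T C : Set X} (hS : S.Finite)
    {k : ℕ} (hTS : T ⊆ S) (hTne : T.Nonempty) (hCS : C ⊆ S) (hCne : C.Nonempty)
    (hCk : C.ncard ≤ k) : kcOpt T k ≤ rad S C + rad S T := by
  have hC := hS.subset hCS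
  have near : ∀ p : X, ∃ q ∈ T, p ∈ S → dist p q ≤ rad S T := fun p => by
    by_cases hp : p ∈ S
    · obtain ⟨q, hq, hpq⟩ := exists_dist_le_rad hS (hS.subset hTS) hTne hp
      exact ⟨q, hq, fun _ => hpq⟩
    · exact ⟨hTne.some, hTne.some_mem, fun h => absurd h hp⟩
  choose f hfT hf using near
  have hfC : f '' C ⊆ T := by
    rintro _ ⟨c, -, rfl⟩
    exact hfT c
  refine (kcOpt_le_rad hfC (hCne.image f) ((Set.ncard_image_le hC).trans hCk)).trans
    (rad_le hTne fun p hp => ?_)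
  obtain ⟨c, hc, hpc⟩ := exists_dist_le_rad hS hC hCne (hTS hp)
  exact ⟨f c, Set.mem_image_of_mem f hc,
    (dist_triangle p c (f c)).trans (add_le_add hpc (hf c (hCS hc)))⟩


/-- If `T ⊆ S` is an `(ε,k)`-coreset for `S` (i.e. `r_T(S) ≤ ε·r*_k(S)`), then
`r*_k(T) ≤ (1+ε)·r*_k(S)`. -/
theorem stmt7 {X : Type*} [MetricSpace X] (S : Set X) (hS : S.Finite)
    (k : ℕ) (hk1 : 1 ≤ k) (hk2 : k < S.ncard)
    (ε : ℝ) (hε : 0 ≤ ε)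
    (T : Set X) (hTS : T ⊆ S) (hTne : T.Nonempty)
    (hcore : rad S T ≤ ε * kcOpt S k) :
    kcOpt T k ≤ (1 + ε) * kcOpt S k := by
  obtain ⟨t, ht⟩ := hTne
  have key : kcOpt T k - ε * kcOpt S k ≤ kcOpt S k := by
    refine le_csInf ⟨_, {t}, Set.singleton_subset_iff.2 (hTS ht), Set.singleton_nonempty t,
      (Set.ncard_singleton t).trans_le hk1, rfl⟩ ?_
    rintro _ ⟨C, hCS, hCne, hCk, rfl⟩
    linarith [kcOpt_le_rad_add_rad hS hTS ⟨t, ht⟩ hCS hCne hCk]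
  linarith
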